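/- Let (T, μ) be a measure space, Φ ∈ L¹(μ), and u ↦ (V_u, b_u) ∈ O(n) × ℝⁿ measurable. Then the Hausdorff operator H f(x) = ∫_T Φ(u) f(V_u x + b_u) dμ(u) is bounded on W^{1,1}(ℝⁿ) with ‖H‖ ≤ (n+1)‖Φ‖_{L¹(μ)}. -/

import Mathlib

open MeasureTheory ENNReal Matrix

/-- `g` is the weak (distributional) partial derivative of `h` in the `j`-th coordinate
direction: `∫ h ∂_j φ = −∫ g φ` for all test functions `φ ∈ C_c^∞(ℝⁿ)`. -/
def HasWeakPartialDeriv {n : ℕ} (j : Fin n)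
    (h g : EuclideanSpace ℝ (Fin n) → ℂ) : Prop :=
  ∀ φ : EuclideanSpace ℝ (Fin n) → ℝ, ContDiff ℝ (⊤ : ℕ∞) φ → HasCompactSupport φ →
    ∫ x, h x * (fderiv ℝ φ x (EuclideanSpace.single j 1) : ℂ) =
      -∫ x, g x * (φ x : ℂ)

open Filter Topology

lemma hop_exists_iso {n : ℕ} (V : Matrix (Fin n) (Fin n) ℝ) (hV : Vᵀ * V = 1) :
    ∃ A : EuclideanSpace ℝ (Fin n) ≃ₗᵢ[ℝ] EuclideanSpace ℝ (Fin n),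
      (∀ x, A x = Matrix.toEuclideanLin V x) := by
  have hV' : V * Vᵀ = 1 := mul_eq_one_comm.mp hV
  refine ⟨{ toFun := fun x => Matrix.toEuclideanLin V x
            map_add' := fun x y => map_add _ x y
            map_smul' := fun c x => map_smul _ c x
            invFun := fun x => Matrix.toEuclideanLin Vᵀ x
            left_inv := fun x => ?_
            right_inv := fun x => ?_
            norm_map' := fun x => ?_ }, fun x => rfl⟩
  · ext i
    simp [Matrix.toLpLin_apply, hV]
  · ext i
    simp [Matrix.toLpLin_apply, hV']
  · have h : inner ℝ (Matrix.toEuclideanLin V x) (Matrix.toEuclideanLin V x) = inner ℝ x x := by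
      rw [← LinearMap.adjoint_inner_right, ← Matrix.toEuclideanLin_conjTranspose_eq_adjoint]
      congr 1
      ext i
      simp [Matrix.toLpLin_apply, hV, Matrix.conjTranspose_eq_transpose_of_trivial]
    rw [real_inner_self_eq_norm_sq, real_inner_self_eq_norm_sq] at h
    exact (pow_left_inj₀ (norm_nonneg _) (norm_nonneg _) two_ne_zero).mp h

lemma hop_entry {n : ℕ} (V : Matrix (Fin n) (Fin n) ℝ) (hV : Vᵀ * V = 1) (k j : Fin n) :
    |V k j| ≤ 1 := by
  have h : (Vᵀ * V) j j = 1 := by rw [hV]; simp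
  rw [Matrix.mul_apply] at h
  have h2 : V k j * V k j ≤ 1 := by
    rw [← h]
    exact Finset.single_le_sum (f := fun k => Vᵀ j k * V k j)
      (fun i _ => mul_self_nonneg (V i j)) (Finset.mem_univ k)
  rw [abs_le_one_iff_mul_self_le_one]
  exact h2

lemma hop_weak_chain {n : ℕ} (V : Matrix (Fin n) (Fin n) ℝ) (hV : Vᵀ * V = 1)
    (b : EuclideanSpace ℝ (Fin n))
    (f : EuclideanSpace ℝ (Fin n) → ℂ) (g : Fin n → EuclideanSpace ℝ (Fin n) → ℂ)
    (hf : Integrable f volume) (hg : ∀ k, Integrable (g k) volume)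
    (hweak : ∀ k, HasWeakPartialDeriv k f (g k)) (j : Fin n) :
    HasWeakPartialDeriv j (fun x => f (Matrix.toEuclideanLin V x + b))
      (fun x => ∑ k, (V k j : ℂ) * g k (Matrix.toEuclideanLin V x + b)) := by
  obtain ⟨A, hA⟩ := hop_exists_iso V hV
  intro φ hφ hφc
  simp only [← hA]
  set ψ : EuclideanSpace ℝ (Fin n) → ℝ := fun y => φ (A.symm (y - b)) with hψ
  have hψs : ContDiff ℝ (⊤ : ℕ∞) ψ := by
    refine hφ.comp ?_
    exact A.symm.contDiff.comp (contDiff_id.sub contDiff_const)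
  have hψc : HasCompactSupport ψ := by
    exact hφc.comp_homeomorph ((Homeomorph.subRight b).trans A.symm.toHomeomorph)
  have hd : ∀ x, fderiv ℝ φ x (EuclideanSpace.single j 1)
      = ∑ k, V k j * fderiv ℝ ψ (A x + b) (EuclideanSpace.single k 1) := by
    intro x
    have hφψ : φ = fun x => ψ (A x + b) := by
      ext x; simp [hψ]
    have h1 : HasFDerivAt φ ((fderiv ℝ ψ (A x + b)).comp
        (A.toContinuousLinearEquiv : EuclideanSpace ℝ (Fin n) →L[ℝ] EuclideanSpace ℝ (Fin n))) x := by
      have h2 : HasFDerivAt ψ (fderiv ℝ ψ (A x + b)) (A x + b) :=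
        (hψs.differentiable (by simp)).differentiableAt.hasFDerivAt
      have h3 : HasFDerivAt (fun x => A x + b) (A.toContinuousLinearEquiv :
          EuclideanSpace ℝ (Fin n) →L[ℝ] EuclideanSpace ℝ (Fin n)) x :=
        (A.toContinuousLinearEquiv.hasFDerivAt).add_const b
      have h4 := HasFDerivAt.comp x h2 h3
      rw [hφψ]
      exact h4
    rw [h1.fderiv]
    have h5 : A (EuclideanSpace.single j 1) = ∑ k, V k j • EuclideanSpace.single k (1 : ℝ) := by
      rw [hA]
      ext i
      simp [Matrix.toLpLin_apply, Finset.sum_apply, Pi.single_apply]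
    simp only [ContinuousLinearMap.comp_apply]
    have h6 : (A.toContinuousLinearEquiv : EuclideanSpace ℝ (Fin n) →L[ℝ] EuclideanSpace ℝ (Fin n))
        (EuclideanSpace.single j 1) = ∑ k, V k j • EuclideanSpace.single k (1 : ℝ) := h5
    rw [h6, map_sum]
    simp
  have mp : MeasurePreserving (fun x => A x + b) volume volume :=
    (measurePreserving_add_right volume b).comp A.measurePreserving
  have me : MeasurableEmbedding (fun x => A x + b) :=
    ((A.toHomeomorph.trans (Homeomorph.addRight b)).measurableEmbedding)
  have hφψ' : ∀ x, φ x = ψ (A x + b) := by intro x; simp [hψ]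
  have hdc : ∀ k, Continuous (fun y => fderiv ℝ ψ y (EuclideanSpace.single k 1)) := fun k =>
    (hψs.continuous_fderiv (by simp)).clm_apply continuous_const
  have hdcs : ∀ k, HasCompactSupport (fun y => fderiv ℝ ψ y (EuclideanSpace.single k 1)) :=
    fun k => hψc.fderiv_apply ℝ _
  have bdd : ∀ h : EuclideanSpace ℝ (Fin n) → ℂ, Integrable h → 
      ∀ χ : EuclideanSpace ℝ (Fin n) → ℝ, Continuous χ → HasCompactSupport χ →
      Integrable (fun y => h y * (χ y : ℂ)) := by
    intro h hh χ hχ hχc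
    obtain ⟨C, hC⟩ := hχc.exists_bound_of_continuous hχ
    exact hh.mul_bdd (c := C) (Complex.continuous_ofReal.comp hχ).aestronglyMeasurable
      (Eventually.of_forall fun x => by simpa using hC x)
  have e1 : ∀ x, f (A x + b) * ((fderiv ℝ φ x (EuclideanSpace.single j 1) : ℝ) : ℂ) =
      (fun y => ∑ k, (V k j : ℂ) * (f y * ((fderiv ℝ ψ y (EuclideanSpace.single k 1) : ℝ) : ℂ)))
        (A x + b) := by
    intro x
    rw [hd]
    push_cast
    rw [Finset.mul_sum]
    exact Finset.sum_congr rfl fun k _ => by ring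
  have e2 : ∀ x, (∑ k, (V k j : ℂ) * g k (A x + b)) * (φ x : ℂ) =
      (fun y => ∑ k, (V k j : ℂ) * (g k y * (ψ y : ℂ))) (A x + b) := by
    intro x
    rw [hφψ', Finset.sum_mul]
    exact Finset.sum_congr rfl fun k _ => by ring
  rw [integral_congr_ae (Eventually.of_forall e1), integral_congr_ae (Eventually.of_forall e2),
    mp.integral_comp me (fun y => ∑ k, (V k j : ℂ) *
      (f y * ((fderiv ℝ ψ y (EuclideanSpace.single k 1) : ℝ) : ℂ))),
    mp.integral_comp me (fun y => ∑ k, (V k j : ℂ) * (g k y * (ψ y : ℂ))),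
    integral_finsetSum, integral_finsetSum, ← Finset.sum_neg_distrib]
  · refine Finset.sum_congr rfl fun k _ => ?_
    rw [integral_const_mul, integral_const_mul, hweak k ψ hψs hψc]
    ring
  · intro k _
    exact (bdd _ (hg k) _ hψs.continuous hψc).const_mul _
  · intro k _
    exact (bdd _ hf _ (hdc k) (hdcs k)).const_mul _

lemma hop_avg {n : ℕ} {T : Type*} [MeasurableSpace T] (μ : Measure T) [SigmaFinite μ]
    (Φ : T → ℂ) (hΦ : Integrable Φ μ)
    (K : T → EuclideanSpace ℝ (Fin n) → ℂ)
    (hK : AEStronglyMeasurable (fun q : T × EuclideanSpace ℝ (Fin n) => K q.1 q.2)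
      (μ.prod volume))
    (C : ℝ≥0∞) (hC : C ≠ ∞) (hKC : ∀ᵐ u ∂μ, eLpNorm (K u) 1 volume ≤ C) :
    Integrable (Function.uncurry fun (u : T) (x : EuclideanSpace ℝ (Fin n)) => Φ u * K u x)
        (μ.prod volume) ∧
      Integrable (fun x => ∫ u, Φ u * K u x ∂μ) volume ∧
      eLpNorm (fun x => ∫ u, Φ u * K u x ∂μ) 1 volume ≤
        ENNReal.ofReal (∫ u, ‖Φ u‖ ∂μ) * C := by
  have hΦp : AEStronglyMeasurable (fun q : T × EuclideanSpace ℝ (Fin n) => Φ q.1)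
      (μ.prod volume) := hΦ.aestronglyMeasurable.comp_fst
  have hm : AEStronglyMeasurable
      (Function.uncurry fun (u : T) (x : EuclideanSpace ℝ (Fin n)) => Φ u * K u x)
      (μ.prod volume) := hΦp.mul hK
  have hΦn : ∫⁻ u, ‖Φ u‖ₑ ∂μ = ENNReal.ofReal (∫ u, ‖Φ u‖ ∂μ) := by
    rw [ofReal_integral_norm_eq_lintegral_enorm hΦ]
  have hbd : ∫⁻ u, ∫⁻ x, ‖Φ u * K u x‖ₑ ∂volume ∂μ ≤ ENNReal.ofReal (∫ u, ‖Φ u‖ ∂μ) * C := by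
    calc ∫⁻ u, ∫⁻ x, ‖Φ u * K u x‖ₑ ∂volume ∂μ
        ≤ ∫⁻ u, ‖Φ u‖ₑ * C ∂μ := by
          refine lintegral_mono_ae ?_
          filter_upwards [hKC] with u hu
          simp only [enorm_mul]
          rw [lintegral_const_mul' _ _ enorm_ne_top]
          gcongr
          rwa [eLpNorm_one_eq_lintegral_enorm] at hu
      _ = _ := by rw [lintegral_mul_const' _ _ hC, hΦn]
  have hint : Integrable
      (Function.uncurry fun (u : T) (x : EuclideanSpace ℝ (Fin n)) => Φ u * K u x)
      (μ.prod volume) := by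
    refine ⟨hm, ?_⟩
    rw [hasFiniteIntegral_iff_enorm, lintegral_prod _ hm.enorm]
    exact lt_of_le_of_lt hbd (ENNReal.mul_lt_top ENNReal.ofReal_lt_top hC.lt_top)
  refine ⟨hint, hint.integral_prod_right, ?_⟩
  rw [eLpNorm_one_eq_lintegral_enorm]
  calc ∫⁻ x, ‖∫ u, Φ u * K u x ∂μ‖ₑ ≤ ∫⁻ x, ∫⁻ u, ‖Φ u * K u x‖ₑ ∂μ :=
        lintegral_mono fun x => enorm_integral_le_lintegral_enorm _
    _ = ∫⁻ u, ∫⁻ x, ‖Φ u * K u x‖ₑ ∂volume ∂μ := (lintegral_lintegral_swap hm.enorm).symm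
    _ ≤ _ := hbd

lemma hop_fubini {n : ℕ} {T : Type*} [MeasurableSpace T] (μ : Measure T) [SigmaFinite μ]
    (Φ : T → ℂ) (K : T → EuclideanSpace ℝ (Fin n) → ℂ)
    (hint : Integrable (Function.uncurry
      fun (u : T) (x : EuclideanSpace ℝ (Fin n)) => Φ u * K u x) (μ.prod volume))
    (χ : EuclideanSpace ℝ (Fin n) → ℝ) (hχ : Continuous χ) (hχc : HasCompactSupport χ) :
    ∫ x, (∫ u, Φ u * K u x ∂μ) * (χ x : ℂ) = ∫ u, Φ u * (∫ x, K u x * (χ x : ℂ)) ∂μ := by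
  obtain ⟨C, hC⟩ := hχc.exists_bound_of_continuous hχ
  have hint2 : Integrable (Function.uncurry
      fun (u : T) (x : EuclideanSpace ℝ (Fin n)) => Φ u * K u x * (χ x : ℂ))
      (μ.prod volume) := by
    refine hint.mul_bdd (c := C) (g := fun q : T × EuclideanSpace ℝ (Fin n) => (χ q.2 : ℂ)) ?_ ?_
    · exact ((Complex.continuous_ofReal.comp hχ).aestronglyMeasurable (μ := volume)).comp_snd
    · exact Eventually.of_forall fun q => by simpa using hC q.2
  simp_rw [← integral_mul_const, ← integral_const_mul]
  rw [← integral_integral_swap hint2]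
  simp_rw [mul_assoc]

lemma hop_limit {n : ℕ} {T : Type*} [MeasurableSpace T] (j : Fin n)
    (F : T × EuclideanSpace ℝ (Fin n) → ℂ) (hF : StronglyMeasurable F) :
    ∃ L : T × EuclideanSpace ℝ (Fin n) → ℂ, StronglyMeasurable L ∧
      ∀ u D, Integrable D volume → HasWeakPartialDeriv j (fun x => F (u, x)) D →
        (fun x => L (u, x)) =ᵐ[volume] D := by
  obtain ⟨ρ, hρ, hρK⟩ : ∃ ρ : ℕ → ContDiffBump (0 : EuclideanSpace ℝ (Fin n)),
      Tendsto (fun m => (ρ m).rOut) atTop (𝓝 0) ∧ ∀ m, (ρ m).rOut ≤ 2 * (ρ m).rIn := by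
    refine ⟨fun m =>
      { rIn := 1 / ((m : ℝ) + 1)
        rOut := 2 * (1 / ((m : ℝ) + 1))
        rIn_pos := by positivity
        rIn_lt_rOut := by
          have : 0 < 1 / ((m : ℝ) + 1) := by positivity
          linarith }, ?_, fun m => le_refl _⟩
    have := (tendsto_one_div_add_atTop_nhds_zero_nat (𝕜 := ℝ)).const_mul 2
    rw [mul_zero] at this
    exact this
  let r : ℕ → EuclideanSpace ℝ (Fin n) → ℝ := fun m => (ρ m).normed volume
  have hrs : ∀ m, ContDiff ℝ (⊤ : ℕ∞) (r m) := fun m => (ρ m).contDiff_normed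
  have hrc : ∀ m, HasCompactSupport (r m) := fun m => (ρ m).hasCompactSupport_normed
  let d : ℕ → EuclideanSpace ℝ (Fin n) → ℝ := fun m z =>
    fderiv ℝ (r m) z (EuclideanSpace.single j 1)
  have hdc : ∀ m, Continuous (d m) := fun m =>
    ((hrs m).continuous_fderiv (by simp)).clm_apply continuous_const
  let L' : ℕ → T × EuclideanSpace ℝ (Fin n) → ℂ := fun m q =>
    ∫ y, F (q.1, y) * (d m (q.2 - y) : ℂ)
  have hL' : ∀ m, StronglyMeasurable (L' m) := by
    intro m
    refine StronglyMeasurable.integral_prod_right'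
      (f := fun p : (T × EuclideanSpace ℝ (Fin n)) × EuclideanSpace ℝ (Fin n) =>
        F (p.1.1, p.2) * (d m (p.1.2 - p.2) : ℂ)) ?_
    refine StronglyMeasurable.mul ?_ ?_
    · exact hF.comp_measurable
        ((measurable_fst.comp measurable_fst).prodMk measurable_snd)
    · have hc : Continuous fun z : EuclideanSpace ℝ (Fin n) => (d m z : ℂ) :=
        Complex.continuous_ofReal.comp (hdc m)
      exact hc.stronglyMeasurable.comp_measurable
        ((measurable_snd.comp measurable_fst).sub measurable_snd)
  refine ⟨fun q => atTop.limUnder fun m => L' m q, StronglyMeasurable.limUnder hL', ?_⟩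
  intro u D hD hw
  have key := ContDiffBump.ae_convolution_tendsto_right_of_locallyIntegrable (μ := volume)
    (K := 2) hρ (Eventually.of_forall hρK) hD.locallyIntegrable
  filter_upwards [key] with x hx
  refine Tendsto.limUnder_eq ?_
  convert hx using 1
  ext m
  rw [convolution_eq_swap]
  have hφs : ContDiff ℝ (⊤ : ℕ∞) (fun y => r m (x - y)) :=
    (hrs m).comp (contDiff_const.sub contDiff_id)
  have hφc : HasCompactSupport (fun y => r m (x - y)) :=
    (hrc m).comp_homeomorph (Homeomorph.subLeft x)
  have h1 := hw _ hφs hφc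
  have h2 : ∀ y, fderiv ℝ (fun y => r m (x - y)) y (EuclideanSpace.single j 1)
      = - d m (x - y) := by
    intro y
    have h3 : HasFDerivAt (r m) (fderiv ℝ (r m) (x - y)) (x - y) :=
      ((hrs m).differentiable (by simp)).differentiableAt.hasFDerivAt
    have h4 := HasFDerivAt.comp y h3 ((hasFDerivAt_id y).const_sub x)
    have h5 : fderiv ℝ (fun y => r m (x - y)) y = _ := h4.fderiv
    rw [h5]
    simp [d]
  simp_rw [h2] at h1
  simp only [Complex.ofReal_neg, mul_neg, integral_neg, neg_inj] at h1
  refine h1.trans ?_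
  refine integral_congr_ae (Eventually.of_forall fun y => ?_)
  simp [r, mul_comm]

/-- Let `(T, μ)` be a measure space, `Φ ∈ L¹(μ)`, and `u ↦ (V_u, b_u) ∈ O(n) × ℝⁿ`
measurable.  Then the Hausdorff operator `H f x = ∫_T Φ(u) f(V_u x + b_u) dμ(u)` is
bounded on `W^{1,1}(ℝⁿ)` with `‖H‖ ≤ (n + 1) ‖Φ‖_{L¹(μ)}`: for `f ∈ W^{1,1}` with
weak partial derivatives `g k`, the function `H f` is integrable with integrable weak
partial derivatives `G j` and
`‖H f‖_{L¹} + Σ_j ‖G j‖_{L¹} ≤ (n + 1) ‖Φ‖_{L¹(μ)} (‖f‖_{L¹} + Σ_k ‖g k‖_{L¹})`. -/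
theorem hausdorff_op_bounded_W11 (n : ℕ)
    {T : Type*} [MeasurableSpace T] (μ : Measure T) [SigmaFinite μ]
    (Φ : T → ℂ) (hΦ : Integrable Φ μ)
    (V : T → Matrix (Fin n) (Fin n) ℝ) (b : T → EuclideanSpace ℝ (Fin n))
    (hV : ∀ u, (V u)ᵀ * V u = 1)
    (f : EuclideanSpace ℝ (Fin n) → ℂ) (g : Fin n → EuclideanSpace ℝ (Fin n) → ℂ)
    (hf : Integrable f volume) (hg : ∀ k, Integrable (g k) volume)
    (hweak : ∀ k, HasWeakPartialDeriv k f (g k))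
    (hmf : AEStronglyMeasurable
      (fun q : T × EuclideanSpace ℝ (Fin n) =>
        f (Matrix.toEuclideanLin (V q.1) q.2 + b q.1)) (μ.prod volume))
    (hmg : ∀ k, AEStronglyMeasurable
      (fun q : T × EuclideanSpace ℝ (Fin n) =>
        g k (Matrix.toEuclideanLin (V q.1) q.2 + b q.1)) (μ.prod volume)) :
    ∃ G : Fin n → EuclideanSpace ℝ (Fin n) → ℂ,
      Integrable (fun x => ∫ u, Φ u * f (Matrix.toEuclideanLin (V u) x + b u) ∂μ) volume ∧
      (∀ j, Integrable (G j) volume ∧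
        HasWeakPartialDeriv j
          (fun x => ∫ u, Φ u * f (Matrix.toEuclideanLin (V u) x + b u) ∂μ) (G j)) ∧
      eLpNorm (fun x => ∫ u, Φ u * f (Matrix.toEuclideanLin (V u) x + b u) ∂μ) 1 volume +
          ∑ j, eLpNorm (G j) 1 volume ≤
        (n + 1) * ENNReal.ofReal (∫ u, ‖Φ u‖ ∂μ) *
          (eLpNorm f 1 volume + ∑ k, eLpNorm (g k) 1 volume) := by
  have hmp : ∀ u, MeasurePreserving
      (fun x => Matrix.toEuclideanLin (V u) x + b u) volume volume := by
    intro u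
    obtain ⟨A, hA⟩ := hop_exists_iso (V u) (hV u)
    simp only [← hA]
    exact (measurePreserving_add_right volume (b u)).comp A.measurePreserving
  have hcomp : ∀ u (h : EuclideanSpace ℝ (Fin n) → ℂ), Integrable h volume →
      Integrable (fun x => h (Matrix.toEuclideanLin (V u) x + b u)) volume ∧
      eLpNorm (fun x => h (Matrix.toEuclideanLin (V u) x + b u)) 1 volume
        = eLpNorm h 1 volume := fun u h hh =>
    ⟨(hmp u).integrable_comp_of_integrable hh,
      eLpNorm_comp_measurePreserving hh.aestronglyMeasurable (hmp u)⟩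
  obtain ⟨F', hF', hFF'⟩ := hmf
  have hFu : ∀ᵐ u ∂μ, ∀ᵐ x ∂(volume : Measure (EuclideanSpace ℝ (Fin n))),
      f (Matrix.toEuclideanLin (V u) x + b u) = F' (u, x) :=
    Measure.ae_ae_of_ae_prod hFF'
  choose L hL hLD using fun j : Fin n => hop_limit j F' hF'
  set S : ℝ≥0∞ := ∑ k, eLpNorm (g k) 1 volume with hS
  have hfin : ∀ h : EuclideanSpace ℝ (Fin n) → ℂ, Integrable h volume →
      eLpNorm h 1 volume ≠ ∞ := fun h hh => (memLp_one_iff_integrable.mpr hh).eLpNorm_ne_top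
  have hSfin : S ≠ ∞ := by
    rw [hS]
    exact ENNReal.sum_ne_top.mpr fun k _ => hfin _ (hg k)
  let D : Fin n → T → EuclideanSpace ℝ (Fin n) → ℂ := fun j u x =>
    ∑ k, (V u k j : ℂ) * g k (Matrix.toEuclideanLin (V u) x + b u)
  have hDint : ∀ j u, Integrable (D j u) volume := fun j u =>
    integrable_finsetSum _ fun k _ => ((hcomp u _ (hg k)).1.const_mul _)
  have hDn : ∀ j u, eLpNorm (D j u) 1 volume ≤ S := by
    intro j u
    have h1 : D j u = ∑ k, fun x => (V u k j : ℂ) *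
        g k (Matrix.toEuclideanLin (V u) x + b u) := by
      ext x; simp [D]
    rw [h1]
    refine (eLpNorm_sum_le (fun k _ =>
      ((hcomp u _ (hg k)).1.const_mul _).aestronglyMeasurable) le_rfl).trans ?_
    refine Finset.sum_le_sum fun k _ => ?_
    rw [← (hcomp u _ (hg k)).2]
    refine eLpNorm_mono fun x => ?_
    rw [norm_mul, Complex.norm_real]
    exact mul_le_of_le_one_left (norm_nonneg _) (hop_entry (V u) (hV u) k j)
  have hLu : ∀ j, ∀ᵐ u ∂μ, (fun x => L j (u, x)) =ᵐ[volume] D j u := by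
    intro j
    filter_upwards [hFu] with u hu
    refine hLD j u _ (hDint j u) ?_
    intro φ hφ hφc
    have h1 := hop_weak_chain (V u) (hV u) (b u) f g hf hg hweak j φ hφ hφc
    refine Eq.trans (integral_congr_ae ?_) h1
    filter_upwards [hu] with x hx
    rw [hx]
  have avF := hop_avg μ Φ hΦ (fun u x => f (Matrix.toEuclideanLin (V u) x + b u))
    ⟨F', hF', hFF'⟩ (eLpNorm f 1 volume) (hfin f hf)
    (Eventually.of_forall fun u => (hcomp u f hf).2.le)
  have avL := fun j => hop_avg μ Φ hΦ (fun u x => L j (u, x))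
    (hL j).aestronglyMeasurable S hSfin (by
      filter_upwards [hLu j] with u hu
      rw [eLpNorm_congr_ae hu]
      exact hDn j u)
  refine ⟨fun j x => ∫ u, Φ u * L j (u, x) ∂μ, avF.2.1, fun j => ⟨(avL j).2.1, ?_⟩, ?_⟩
  · intro φ hφ hφc
    rw [hop_fubini μ Φ _ avF.1 (fun x => fderiv ℝ φ x (EuclideanSpace.single j 1))
      ((hφ.continuous_fderiv (by simp)).clm_apply continuous_const) (hφc.fderiv_apply ℝ _),
      hop_fubini μ Φ _ (avL j).1 φ hφ.continuous hφc, ← integral_neg]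
    refine integral_congr_ae ?_
    filter_upwards [hLu j] with u hu
    have h1 := hop_weak_chain (V u) (hV u) (b u) f g hf hg hweak j φ hφ hφc
    have h2 : ∫ x, L j (u, x) * (φ x : ℂ) = ∫ x, D j u x * (φ x : ℂ) := by
      refine integral_congr_ae ?_
      filter_upwards [hu] with x hx
      rw [hx]
    rw [h1, h2, mul_neg]
  · set I := ENNReal.ofReal (∫ u, ‖Φ u‖ ∂μ) with hI
    calc _ ≤ I * eLpNorm f 1 volume + ∑ j : Fin n, I * S :=
          add_le_add avF.2.2 (Finset.sum_le_sum fun j _ => (avL j).2.2)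
      _ = I * eLpNorm f 1 volume + n * (I * S) := by simp
      _ ≤ (I * eLpNorm f 1 volume + n * (I * S)) + (n * (I * eLpNorm f 1 volume) + I * S) :=
          le_self_add
      _ = (n + 1) * I * (eLpNorm f 1 volume + S) := by ring
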